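/- If G is a 2-free circular interval digraph on n vertices, then the number of induced 3-vertex directed paths of G is at most n^3/16, and this bound is attained for infinitely many n. -/

import Mathlib

/-- A digraph (given by its edge relation) is 2-free: no loops and no 2-cycles. -/
def TwoFree {V : Type*} (E : V → V → Prop) : Prop :=
  (∀ v, ¬ E v v) ∧ ∀ u v, ¬ (E u v ∧ E v u)

/-- `(u, w, v)` is an induced directed 3-vertex path. -/
def InducedP3 {V : Type*} (E : V → V → Prop) (u w v : V) : Prop :=
  u ≠ w ∧ w ≠ v ∧ u ≠ v ∧ E u w ∧ E w v ∧ ¬ E w u ∧ ¬ E v w ∧ ¬ E u v ∧ ¬ E v u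

instance {V : Type*} [DecidableEq V] (E : V → V → Prop) [DecidableRel E] (u w v : V) :
    Decidable (InducedP3 E u w v) := by unfold InducedP3; infer_instance

/-- The clockwise circular distance (the "length" of the pair `(u,v)`) on `Fin n`. -/
def cdist (n : ℕ) (u v : Fin n) : ℕ := ((v : ℕ) + n - (u : ℕ)) % n

/-- `E` is a circular interval digraph with respect to the standard circular order of
`Fin n`: whenever `u, v, w` are distinct and in clockwise order (i.e. `v` lies strictly
between `u` and `w` clockwise) and `u → w` is an edge, then `u → v` and `v → w` are edges. -/
def CircInterval (n : ℕ) (E : Fin n → Fin n → Prop) : Prop :=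
  ∀ u v w : Fin n, u ≠ v → v ≠ w → u ≠ w →
    cdist n u v < cdist n u w → E u w → E u v ∧ E v w

/-- The number of induced 3-vertex directed paths. -/
def p3Count (n : ℕ) (E : Fin n → Fin n → Prop) [DecidableRel E] : ℕ :=
  ((Finset.univ : Finset (Fin n × Fin n × Fin n)).filter
    (fun p => InducedP3 E p.1 p.2.1 p.2.2)).card

/-- `ξ(G)`: the number of pairs (edge `uv`, non-edge `wx`) with `d(u,v) > d(w,x)`. -/
def xiCount (n : ℕ) (E : Fin n → Fin n → Prop) [DecidableRel E] : ℕ :=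
  ((Finset.univ : Finset (Fin n × Fin n × Fin n × Fin n)).filter
    (fun p => E p.1 p.2.1 ∧ p.2.2.1 ≠ p.2.2.2 ∧ ¬ E p.2.2.1 p.2.2.2 ∧
      ¬ E p.2.2.2 p.2.2.1 ∧ cdist n p.2.2.1 p.2.2.2 < cdist n p.1 p.2.1)).card

/-- `E` is optimal: it is a 2-free circular interval digraph on `n` vertices maximizing
the number of induced 3-vertex paths, and subject to that minimizing `ξ`. -/
def Optimal (n : ℕ) (E : Fin n → Fin n → Prop) [DecidableRel E] : Prop :=
  TwoFree E ∧ CircInterval n E ∧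
    ∀ (F : Fin n → Fin n → Prop) (instF : DecidableRel F), TwoFree F → CircInterval n F →
      @p3Count n F instF ≤ p3Count n E ∧
        (@p3Count n F instF = p3Count n E → xiCount n E ≤ @xiCount n F instF)

open Finset

theorem cdist_eq_ite {n : ℕ} (u v : Fin n) :
    cdist n u v = if (u : ℕ) ≤ v then (v : ℕ) - u else (v : ℕ) + n - u := by
  have hu := u.isLt
  have hv := v.isLt
  unfold cdist
  split_ifs with h
  · have : (v : ℕ) + n - u = (v - u) + n := by omega
    rw [this, Nat.add_mod_right, Nat.mod_eq_of_lt (by omega)]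
  · exact Nat.mod_eq_of_lt (by omega)

theorem cdist_lt {n : ℕ} (u v : Fin n) : cdist n u v < n := by
  have := u.isLt
  have := v.isLt
  rw [cdist_eq_ite]
  split_ifs <;> omega

theorem cdist_eq_zero_iff {n : ℕ} {u v : Fin n} : cdist n u v = 0 ↔ u = v := by
  have := u.isLt
  have := v.isLt
  rw [cdist_eq_ite, Fin.ext_iff]
  split_ifs <;> omega

theorem cdist_right_injective {n : ℕ} (u : Fin n) : Function.Injective (cdist n u) := by
  intro v w h
  have := u.isLt
  have := v.isLt
  have := w.isLt
  rw [cdist_eq_ite, cdist_eq_ite] at h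
  rw [Fin.ext_iff]
  split_ifs at h <;> omega

theorem cdist_left_injective {n : ℕ} (v : Fin n) :
    Function.Injective (fun u => cdist n u v) := by
  intro u w h
  have := u.isLt
  have := v.isLt
  have := w.isLt
  simp only [cdist_eq_ite] at h
  rw [Fin.ext_iff]
  split_ifs at h <;> omega

theorem exists_cdist_right_eq {n : ℕ} (u : Fin n) {j : ℕ} (hj : j < n) :
    ∃ v, cdist n u v = j := by
  have := u.isLt
  by_cases h : (u : ℕ) + j < n
  · refine ⟨⟨u + j, h⟩, ?_⟩
    rw [cdist_eq_ite]
    dsimp only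
    split_ifs <;> omega
  · refine ⟨⟨u + j - n, by omega⟩, ?_⟩
    rw [cdist_eq_ite]
    dsimp only
    split_ifs <;> omega

theorem exists_cdist_left_eq {n : ℕ} (v : Fin n) {j : ℕ} (hj : j < n) :
    ∃ u, cdist n u v = j := by
  have := v.isLt
  by_cases h : j ≤ (v : ℕ)
  · refine ⟨⟨v - j, by omega⟩, ?_⟩
    rw [cdist_eq_ite]
    dsimp only
    split_ifs <;> omega
  · refine ⟨⟨v + n - j, by omega⟩, ?_⟩
    rw [cdist_eq_ite]
    dsimp only
    split_ifs <;> omega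

/-- The distance from `w` to `v` in terms of the distances from a third point. -/
theorem cdist_eq_of_base {n : ℕ} (u w v : Fin n) :
    cdist n w v = if cdist n u w ≤ cdist n u v then cdist n u v - cdist n u w
      else cdist n u v + n - cdist n u w := by
  have := u.isLt
  have := v.isLt
  have := w.isLt
  simp only [cdist_eq_ite]
  split_ifs <;> omega

theorem cdist_symm_eq {n : ℕ} (u v : Fin n) :
    cdist n v u = if cdist n u v = 0 then 0 else n - cdist n u v := by
  have := u.isLt
  have := v.isLt
  simp only [cdist_eq_ite]
  split_ifs <;> omega

theorem sum_cdist {M : Type*} [AddCommMonoid M] {n : ℕ} (u : Fin n) (f : ℕ → M) :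
    ∑ v, f (cdist n u v) = ∑ i ∈ range n, f i := by
  refine sum_bij (fun v _ => cdist n u v) (fun v _ => mem_range.2 (cdist_lt u v))
    (fun v _ w _ h => cdist_right_injective u h) (fun j hj => ?_) (fun _ _ => rfl)
  obtain ⟨v, hv⟩ := exists_cdist_right_eq u (mem_range.1 hj)
  exact ⟨v, mem_univ _, hv⟩

theorem card_filter_cdist {n : ℕ} (u : Fin n) (p : ℕ → Prop) [DecidablePred p] :
    #{v | p (cdist n u v)} = #{i ∈ range n | p i} := by
  rw [card_filter, card_filter]
  exact sum_cdist u fun i => if p i then 1 else 0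

/-- Summation over a set whose labels form an initial segment of the positive integers. -/
theorem sum_comp_eq_sum_Icc_card {α M : Type*} [AddCommMonoid M] {c : α → ℕ}
    (hc : Function.Injective c) {N : ℕ} (hlt : ∀ x, c x < N) (hsurj : ∀ j < N, ∃ x, c x = j)
    {S : Finset α} (h0 : ∀ x ∈ S, c x ≠ 0)
    (hdown : ∀ x ∈ S, ∀ y, c y ≠ 0 → c y < c x → y ∈ S) (f : ℕ → M) :
    ∑ x ∈ S, f (c x) = ∑ i ∈ Icc 1 #S, f i := by
  have himg : S.image c = Icc 1 #S := by
    obtain ⟨m, hm⟩ : ∃ m, S.image c = Icc 1 m := by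
      rcases S.eq_empty_or_nonempty with rfl | hS
      · exact ⟨0, by simp⟩
      obtain ⟨x, hx, hmax⟩ := S.exists_max_image c hS
      refine ⟨c x, ?_⟩
      ext j
      rw [mem_image, mem_Icc]
      constructor
      · rintro ⟨y, hy, rfl⟩
        exact ⟨Nat.pos_of_ne_zero (h0 y hy), hmax y hy⟩
      · rintro ⟨h1, h2⟩
        obtain ⟨y, rfl⟩ := hsurj j (h2.trans_lt (hlt x))
        rcases h2.lt_or_eq with h | h
        · exact ⟨y, hdown x hx y (by omega) h, rfl⟩
        · exact ⟨x, hx, h.symm⟩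
    have hcard : #S = m := by
      rw [← card_image_of_injective S hc, hm, Nat.card_Icc, Nat.add_sub_cancel]
    rw [hm, hcard]
  rw [← himg, sum_image hc.injOn]

section Bound

variable {n : ℕ} {E : Fin n → Fin n → Prop} [DecidableRel E]

theorem sum_out_eq {M : Type*} [AddCommMonoid M] (hE : TwoFree E) (hI : CircInterval n E)
    (v : Fin n) (f : ℕ → M) :
    ∑ w with E v w, f (cdist n v w) = ∑ i ∈ Icc 1 #{w | E v w}, f i := by
  refine sum_comp_eq_sum_Icc_card (cdist_right_injective v) (cdist_lt v)
    (fun j hj => exists_cdist_right_eq v hj) ?_ ?_ f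
  · intro w hw h
    rw [mem_filter] at hw
    rw [cdist_eq_zero_iff] at h
    exact hE.1 v (h ▸ hw.2)
  · intro w hw y hy hlt
    rw [mem_filter] at hw ⊢
    have hvy : v ≠ y := fun h => hy (cdist_eq_zero_iff.2 h)
    have hvw : v ≠ w := fun h => hE.1 v (by simpa [← h] using hw.2)
    have hyw : y ≠ w := by rintro rfl; exact lt_irrefl _ hlt
    exact ⟨mem_univ _, (hI v y w hvy hyw hvw hlt hw.2).1⟩

theorem sum_in_eq {M : Type*} [AddCommMonoid M] (hE : TwoFree E) (hI : CircInterval n E)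
    (w : Fin n) (f : ℕ → M) :
    ∑ v with E v w, f (cdist n v w) = ∑ i ∈ Icc 1 #{v | E v w}, f i := by
  refine sum_comp_eq_sum_Icc_card (c := fun v => cdist n v w) (cdist_left_injective w)
    (fun v => cdist_lt v w) (fun j hj => exists_cdist_left_eq w hj) ?_ ?_ f
  · intro v hv h
    rw [mem_filter] at hv
    rw [cdist_eq_zero_iff] at h
    exact hE.1 v (by simpa [← h] using hv.2)
  · intro v hv y hy hlt
    rw [mem_filter] at hv ⊢
    have hyw : y ≠ w := fun h => hy (cdist_eq_zero_iff.2 h)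
    have hvw : v ≠ w := fun h => hE.1 v (by simpa [← h] using hv.2)
    have hvy : v ≠ y := by rintro rfl; exact lt_irrefl _ hlt
    have hlt' : cdist n v y < cdist n v w := by
      have h1 := cdist_eq_of_base v y w
      have h2 := cdist_lt v y
      split_ifs at h1 with h
      · refine h.lt_of_ne fun h3 => hyw (cdist_right_injective v h3)
      · omega
    exact ⟨mem_univ _, (hI v y w hvy hyw hvw hlt' hv.2).2⟩

theorem cdist_le_card_between (hI : CircInterval n E) {v w : Fin n} (hvw : E v w) :
    cdist n v w - 1 ≤ #{x | E v x ∧ E x w} := by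
  have h : #{x | 0 < cdist n v x ∧ cdist n v x < cdist n v w} = cdist n v w - 1 := by
    rw [card_filter_cdist v fun i => 0 < i ∧ i < cdist n v w]
    have := cdist_lt v w
    have : {i ∈ range n | 0 < i ∧ i < cdist n v w} = Ioo 0 (cdist n v w) := by
      ext i
      simp only [mem_filter, mem_range, mem_Ioo]
      omega
    rw [this, Nat.card_Ioo]
    omega
  rw [← h]
  refine card_le_card fun x hx => ?_
  rw [mem_filter] at hx ⊢
  have hvx : v ≠ x := fun h => hx.2.1.ne' (cdist_eq_zero_iff.2 h)
  have hxw : x ≠ w := by rintro rfl; exact lt_irrefl _ hx.2.2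
  have hne : v ≠ w := by
    rintro rfl
    have := cdist_eq_zero_iff.2 (rfl : v = v)
    omega
  exact ⟨mem_univ _, hI v x w hvx hxw hne hx.2.2 hvw⟩

theorem card_add_card_le_card_cyclic (hE : TwoFree E) (hI : CircInterval n E) {v w : Fin n}
    (hvw : E v w) :
    #{x | E w x} + #{x | E x v} + cdist n v w ≤ (n - 1) + #{x | E w x ∧ E x v} := by
  have h : #{x | cdist n v w < cdist n v x} = n - 1 - cdist n v w := by
    rw [card_filter_cdist v fun i => cdist n v w < i]
    have : {i ∈ range n | cdist n v w < i} = Ioo (cdist n v w) n := by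
      ext i
      simp only [mem_filter, mem_range, mem_Ioo]
      omega
    rw [this, Nat.card_Ioo]
    omega
  have hne : v ≠ w := by
    rintro rfl
    exact hE.1 _ hvw
  have hsub : ({x | E w x} : Finset (Fin n)) ∪
      ({x | E x v} : Finset (Fin n)) ⊆
      ({x | cdist n v w < cdist n v x} : Finset (Fin n)) := by
    intro x hx
    simp only [mem_union, mem_filter, mem_univ, true_and] at hx ⊢
    by_contra! hle
    have hxw : x ≠ w := by
      rintro rfl
      rcases hx with hx | hx
      · exact hE.1 _ hx
      · exact hE.2 _ _ ⟨hx, hvw⟩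
    have hvx : v ≠ x := by
      rintro rfl
      rcases hx with hx | hx
      · exact hE.2 _ _ ⟨hx, hvw⟩
      · exact hE.1 _ hx
    have hlt := hle.lt_of_ne fun h => hxw (cdist_right_injective v h)
    obtain ⟨h1, h2⟩ := hI v x w hvx hxw hne hlt hvw
    rcases hx with hx | hx
    · exact hE.2 _ _ ⟨hx, h2⟩
    · exact hE.2 _ _ ⟨hx, h1⟩
  have hcard := card_le_card hsub
  have hui := card_union_add_card_inter ({x | E w x} : Finset (Fin n)) {x | E x v}
  rw [← filter_and] at hui
  have := cdist_lt v w
  omega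

theorem p3Count_eq_sum (n : ℕ) (E : Fin n → Fin n → Prop) [DecidableRel E] :
    p3Count n E = ∑ u, ∑ x, #{v | InducedP3 E u x v} := by
  rw [p3Count, card_filter, Fintype.sum_prod_type]
  simp only [Fintype.sum_prod_type, card_filter]

/-- Directed two-edge walks are counted by the induced paths together with the transitive and
the cyclic triangles. -/
theorem sum_degree_mul_eq (hE : TwoFree E) :
    ∑ x, #{w | E x w} * #{u | E u x} = p3Count n E +
      ∑ v, ∑ w with E v w, (#{x | E v x ∧ E x w} + #{x | E w x ∧ E x v}) := by
  have h1 : ∑ x, #{w | E x w} * #{u | E u x} =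
      ∑ u, ∑ x, ∑ v, if E u x ∧ E x v then 1 else 0 := by
    rw [sum_comm]
    refine sum_congr rfl fun x _ => ?_
    simp only [card_filter]
    rw [mul_comm, sum_mul_sum]
    refine sum_congr rfl fun u _ => sum_congr rfl fun v _ => ?_
    by_cases h : E u x <;> by_cases h' : E x v <;> simp [h, h']
  have h3 : ∑ v, ∑ w with E v w, #{x | E v x ∧ E x w} =
      ∑ u, ∑ x, ∑ v, if E u v ∧ E u x ∧ E x v then 1 else 0 := by
    refine sum_congr rfl fun u _ => ?_
    rw [sum_comm, sum_filter]
    refine sum_congr rfl fun v _ => ?_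
    rw [card_filter]
    by_cases h : E u v <;> simp [h]
  have h4 : ∑ v, ∑ w with E v w, #{x | E w x ∧ E x v} =
      ∑ u, ∑ x, ∑ v, if E v u ∧ E u x ∧ E x v then 1 else 0 := by
    have : ∀ v, ∑ w with E v w, #{x | E w x ∧ E x v} =
        ∑ u, ∑ x, if E v u ∧ E u x ∧ E x v then 1 else 0 := by
      intro v
      rw [sum_filter]
      refine sum_congr rfl fun u _ => ?_
      rw [card_filter]
      by_cases h : E v u <;> simp [h]
    rw [sum_congr rfl fun v _ => this v, sum_comm]
    exact sum_congr rfl fun u _ => sum_comm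
  simp only [sum_add_distrib]
  rw [h1, p3Count_eq_sum, h3, h4]
  simp only [card_filter]
  simp only [← sum_add_distrib]
  refine sum_congr rfl fun u _ => sum_congr rfl fun x _ => sum_congr rfl fun v _ => ?_
  unfold InducedP3
  have e1 := hE.1
  have e2 := hE.2
  by_cases h : E u x ∧ E x v
  · obtain ⟨ha, hb⟩ := h
    have hux : u ≠ x := by rintro rfl; exact e1 _ ha
    have hxv : x ≠ v := by rintro rfl; exact e1 _ hb
    have huv : u ≠ v := by rintro rfl; exact e2 _ _ ⟨ha, hb⟩
    have hxu : ¬ E x u := fun h => e2 _ _ ⟨ha, h⟩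
    have hvx : ¬ E v x := fun h => e2 _ _ ⟨hb, h⟩
    have := e2 u v
    by_cases hc : E u v <;> by_cases hd : E v u <;> simp_all
  · have h' : E u x → ¬ E x v := fun h1 h2 => h ⟨h1, h2⟩
    by_cases hc : E u x
    · simp [h' hc]
    · simp [hc]

end Bound

/-- The edge weight used to bound the number of triangles from below. -/
def triangleWeight (n t i : ℕ) : ℤ :=
  ((i : ℤ) - 1) + if t < i then (i : ℤ) - (n - 1) else 0

theorem two_mul_sum_triangleWeight (n t m : ℕ) :
    2 * ∑ i ∈ Icc 1 m, triangleWeight n t i = (m : ℤ) * (m - 1) +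
      if t < m then (m : ℤ) * (m + 1) - t * (t + 1) - 2 * (n - 1) * (m - t) else 0 := by
  induction m with
  | zero => simp
  | succ m ih =>
    rw [sum_Icc_succ_top (by omega), mul_add, ih, triangleWeight]
    rcases lt_trichotomy t m with h | h | h
    · rw [if_pos h, if_pos (by omega), if_pos (by omega)]
      push_cast
      ring
    · subst h
      rw [if_neg (by omega), if_pos (by omega), if_pos (by omega)]
      push_cast
      ring
    · rw [if_neg (by omega), if_neg (by omega), if_neg (by omega)]
      push_cast
      ring

theorem degree_bound_of_le {n t a d : ℤ} (ht : t = n / 4) :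
    16 * (a * d - d * (a - t) - a * (d - t)) -
      4 * ((a * (a - 1) + (a * (a + 1) - t * (t + 1) - 2 * (n - 1) * (a - t))) +
        (d * (d - 1) + (d * (d + 1) - t * (t + 1) - 2 * (n - 1) * (d - t)))) ≤ n ^ 2 := by
  obtain ⟨r, hr, hr0, hr4⟩ : ∃ r, n = 4 * t + r ∧ 0 ≤ r ∧ r < 4 :=
    ⟨n - 4 * t, by ring, by omega, by omega⟩
  subst hr
  interval_cases r
  · obtain h | h : a + d - 3 * t + 1 ≤ 0 ∨ 0 ≤ a + d - 3 * t := by omega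
    · nlinarith [mul_nonneg (neg_nonneg.2 h) (by linarith : 0 ≤ -(a + d - 3 * t))]
    · nlinarith [mul_nonneg h (by linarith : 0 ≤ a + d - 3 * t + 1)]
  · nlinarith [sq_nonneg (a + d - 3 * t)]
  · nlinarith [sq_nonneg (2 * (a + d - 3 * t) - 1)]
  · nlinarith [sq_nonneg (a + d - 3 * t - 1)]

theorem degree_bound (n a d : ℕ) :
    16 * ((a : ℤ) * d - d * (a - n / 4 : ℕ) - a * (d - n / 4 : ℕ)) -
      8 * (∑ i ∈ Icc 1 a, triangleWeight n (n / 4) i +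
        ∑ i ∈ Icc 1 d, triangleWeight n (n / 4) i) ≤ (n : ℤ) ^ 2 := by
  have key : ∀ a d : ℕ, _ :=
    fun a d => degree_bound_of_le (n := n) (t := (n / 4 : ℕ)) (a := a) (d := d) (by simp)
  have ha := two_mul_sum_triangleWeight n (n / 4) a
  have hd := two_mul_sum_triangleWeight n (n / 4) d
  have htn : 4 * ((n / 4 : ℕ) : ℤ) ≤ n := by omega
  generalize n / 4 = t at *
  have mixed : ∀ a d : ℤ, 0 ≤ a → a ≤ t → (t : ℤ) ≤ d →
      16 * (a * d - a * (d - t)) - 4 * (a * (a - 1) +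
        (d * (d - 1) + (d * (d + 1) - t * (t + 1) - 2 * (n - 1) * (d - t)))) ≤ (n : ℤ) ^ 2 := by
    intro a d h0 hat htd
    lift d to ℕ using by linarith
    have := key t d
    nlinarith [mul_nonneg (by linarith : 0 ≤ (t : ℤ) - a) (by linarith : 0 ≤ 3 * (t : ℤ) - a + 1)]
  rcases le_total t a with h1 | h1 <;> rcases le_total t d with h2 | h2
  · rw [Nat.cast_sub h1, Nat.cast_sub h2]
    have ha' : (if t < a then (a : ℤ) * (a + 1) - t * (t + 1) - 2 * (n - 1) * (a - t) else 0) =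
      (a : ℤ) * (a + 1) - t * (t + 1) - 2 * (n - 1) * (a - t) := by
      split_ifs with h
      · rfl
      · obtain rfl : a = t := by omega
        ring
    have hd' : (if t < d then (d : ℤ) * (d + 1) - t * (t + 1) - 2 * (n - 1) * (d - t) else 0) =
      (d : ℤ) * (d + 1) - t * (t + 1) - 2 * (n - 1) * (d - t) := by
      split_ifs with h
      · rfl
      · obtain rfl : d = t := by omega
        ring
    rw [ha'] at ha
    rw [hd'] at hd
    linarith [key a d]
  · rw [if_neg (by omega)] at hd
    rw [Nat.sub_eq_zero_of_le h2, Nat.cast_sub h1]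
    have ha' : (if t < a then (a : ℤ) * (a + 1) - t * (t + 1) - 2 * (n - 1) * (a - t) else 0) =
      (a : ℤ) * (a + 1) - t * (t + 1) - 2 * (n - 1) * (a - t) := by
      split_ifs with h
      · rfl
      · obtain rfl : a = t := by omega
        ring
    rw [ha'] at ha
    have := mixed d a (by positivity) (by exact_mod_cast h2) (by exact_mod_cast h1)
    push_cast
    linarith
  · rw [if_neg (by omega)] at ha
    rw [Nat.sub_eq_zero_of_le h1, Nat.cast_sub h2]
    have hd' : (if t < d then (d : ℤ) * (d + 1) - t * (t + 1) - 2 * (n - 1) * (d - t) else 0) =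
      (d : ℤ) * (d + 1) - t * (t + 1) - 2 * (n - 1) * (d - t) := by
      split_ifs with h
      · rfl
      · obtain rfl : d = t := by omega
        ring
    rw [hd'] at hd
    have := mixed a d (by positivity) (by exact_mod_cast h1) (by exact_mod_cast h2)
    push_cast
    linarith
  · rw [if_neg (by omega)] at ha hd
    rw [Nat.sub_eq_zero_of_le h1, Nat.sub_eq_zero_of_le h2]
    push_cast
    zify at h1 h2
    have ha0 : (0 : ℤ) ≤ a := by positivity
    have hd0 : (0 : ℤ) ≤ d := by positivity
    have h4 : (t : ℤ) ≤ t * t := by exact_mod_cast Nat.le_mul_self t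
    have h5 : (a : ℤ) * a ≤ t * t := mul_le_mul h1 h1 ha0 (by positivity)
    have h6 : (d : ℤ) * d ≤ t * t := mul_le_mul h2 h2 hd0 (by positivity)
    have h7 : 16 * ((t : ℤ) * t) ≤ n ^ 2 := by nlinarith
    nlinarith [sq_nonneg ((a : ℤ) - d)]

theorem sixteen_mul_p3Count_le {n : ℕ} {E : Fin n → Fin n → Prop} [DecidableRel E]
    (hE : TwoFree E) (hI : CircInterval n E) : 16 * (p3Count n E : ℤ) ≤ (n : ℤ) ^ 3 := by
  set t := n / 4 with ht
  let a : Fin n → ℕ := fun x => #{w | E x w}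
  let d : Fin n → ℕ := fun x => #{u | E u x}
  have hcount : ∑ x, (a x : ℤ) * d x = p3Count n E +
      ∑ v, ∑ w with E v w, ((#{x | E v x ∧ E x w} : ℤ) + #{x | E w x ∧ E x v}) := by
    exact_mod_cast sum_degree_mul_eq hE
  have hedge : ∀ v w, E v w →
      triangleWeight n t (cdist n v w) +
        (if t < cdist n v w then (d v : ℤ) else 0) + (if t < cdist n v w then (a w : ℤ) else 0) ≤
      (#{x | E v x ∧ E x w} : ℤ) + #{x | E w x ∧ E x v} := by
    intro v w h
    have h1 := cdist_le_card_between hI h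
    have h2 := card_add_card_le_card_cyclic hE hI h
    have h3 := v.pos
    simp only [triangleWeight, a, d]
    split_ifs <;> omega
  have hsum : ∑ v, ∑ w with E v w, (triangleWeight n t (cdist n v w) +
        (if t < cdist n v w then (d v : ℤ) else 0) + (if t < cdist n v w then (a w : ℤ) else 0)) ≤
      ∑ v, ∑ w with E v w, ((#{x | E v x ∧ E x w} : ℤ) + #{x | E w x ∧ E x v}) :=
    sum_le_sum fun v _ => sum_le_sum fun w hw => hedge v w (mem_filter.1 hw).2
  have hswap : ∀ f : Fin n → Fin n → ℤ,
      ∑ v, ∑ w with E v w, f v w = ∑ w, ∑ v with E v w, f v w := by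
    intro f
    simp only [sum_filter]
    exact sum_comm
  have hlong : ∀ (m : ℕ) (c : ℤ), ∑ i ∈ Icc 1 m, (if t < i then c else 0) = c * (m - t : ℕ) := by
    intro m c
    have : {i ∈ Icc 1 m | t < i} = Ioc t m := by
      ext i
      simp only [mem_filter, mem_Icc, mem_Ioc]
      omega
    rw [← sum_filter, this, sum_const, Nat.card_Ioc, nsmul_eq_mul, mul_comm]
  have hW : ∑ v, ∑ w with E v w, triangleWeight n t (cdist n v w) =
      ∑ v, ∑ i ∈ Icc 1 (a v), triangleWeight n t i :=
    sum_congr rfl fun v _ => sum_out_eq hE hI v _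
  have hW' : ∑ v, ∑ w with E v w, triangleWeight n t (cdist n v w) =
      ∑ v, ∑ i ∈ Icc 1 (d v), triangleWeight n t i := by
    rw [hswap]
    exact sum_congr rfl fun w _ => sum_in_eq hE hI w _
  have hD : ∑ v, ∑ w with E v w, (if t < cdist n v w then (d v : ℤ) else 0) =
      ∑ v, (d v : ℤ) * (a v - t : ℕ) := by
    refine sum_congr rfl fun v _ => ?_
    rw [sum_out_eq hE hI v fun i => if t < i then (d v : ℤ) else 0, hlong]
  have hA : ∑ v, ∑ w with E v w, (if t < cdist n v w then (a w : ℤ) else 0) =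
      ∑ v, (a v : ℤ) * (d v - t : ℕ) := by
    rw [hswap]
    refine sum_congr rfl fun w _ => ?_
    rw [sum_in_eq hE hI w fun i => if t < i then (a w : ℤ) else 0, hlong]
  have hbound := sum_le_sum fun v (_ : v ∈ (univ : Finset (Fin n))) => degree_bound n (a v) (d v)
  rw [← ht] at hbound
  simp only [sum_sub_distrib, sum_add_distrib, ← mul_sum] at hbound hsum hcount
  rw [sum_const, card_univ, Fintype.card_fin, nsmul_eq_mul] at hbound
  have : (n : ℤ) * n ^ 2 = n ^ 3 := by ring
  linarith

theorem p3Count_comp_perm {n : ℕ} (E : Fin n → Fin n → Prop) [DecidableRel E]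
    (σ : Equiv.Perm (Fin n)) :
    p3Count n (fun i j => E (σ i) (σ j)) = p3Count n E := by
  refine card_equiv (σ.prodCongr (σ.prodCongr σ)) fun p => ?_
  rw [mem_filter, mem_filter]
  simp [InducedP3]

/-- The circular digraph in which each vertex points to the next `β` vertices. -/
def circPower (n β : ℕ) (u v : Fin n) : Prop := 1 ≤ cdist n u v ∧ cdist n u v ≤ β

instance (n β : ℕ) : DecidableRel (circPower n β) := by
  intro u v
  unfold circPower
  infer_instance

theorem twoFree_circPower {n β : ℕ} (h : 2 * β < n) : TwoFree (circPower n β) := by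
  refine ⟨fun v hv => ?_, fun u v huv => ?_⟩
  · have := cdist_eq_zero_iff.2 (rfl : v = v)
    have := hv.1
    omega
  · obtain ⟨⟨h1, h2⟩, h3, h4⟩ := huv
    have := cdist_symm_eq u v
    split_ifs at this <;> omega

theorem circInterval_circPower (n β : ℕ) : CircInterval n (circPower n β) := by
  intro u v w huv hvw _ hlt h
  obtain ⟨_, h2⟩ := h
  have h3 := mt cdist_eq_zero_iff.1 huv
  have h5 := cdist_eq_of_base u v w
  unfold circPower
  split_ifs at h5 <;> omega

theorem inducedP3_circPower_iff {n β : ℕ} (h : 2 * β < n) (u w v : Fin n) :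
    InducedP3 (circPower n β) u w v ↔ (1 ≤ cdist n u w ∧ cdist n u w ≤ β) ∧
      β < cdist n u v ∧ cdist n u v ≤ cdist n u w + β ∧ cdist n u v + β < n := by
  have h1 := cdist_symm_eq u w
  have h2 := cdist_symm_eq u v
  have h3 := cdist_symm_eq w v
  have h4 := cdist_eq_of_base u w v
  have l1 := cdist_lt u w
  have l2 := cdist_lt u v
  unfold InducedP3 circPower
  simp only [← cdist_eq_zero_iff, ne_eq]
  split_ifs at h1 h2 h3 h4 <;> omega

theorem sum_Icc_min (m k : ℕ) :
    ∑ i ∈ Icc 1 (m + k), min i m = ∑ i ∈ Icc 1 m, i + k * m := by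
  induction k with
  | zero =>
    rw [zero_mul, add_zero, add_zero]
    exact sum_congr rfl fun i hi => min_eq_left (mem_Icc.1 hi).2
  | succ k ih =>
    rw [← add_assoc, sum_Icc_succ_top (by omega), ih, min_eq_right (by omega)]
    ring

theorem p3Count_circPower (k : ℕ) :
    p3Count (8 * k + 4) (circPower (8 * k + 4) (3 * k + 1)) = 4 * (2 * k + 1) ^ 3 := by
  have hcount : ∀ i, 1 ≤ i ∧ i ≤ 3 * k + 1 →
      #{l ∈ range (8 * k + 4) | 3 * k + 1 < l ∧ l ≤ i + (3 * k + 1) ∧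
        l + (3 * k + 1) < 8 * k + 4} = min i (2 * k + 1) := by
    intro i _
    have : {l ∈ range (8 * k + 4) | 3 * k + 1 < l ∧ l ≤ i + (3 * k + 1) ∧
        l + (3 * k + 1) < 8 * k + 4} = Ioc (3 * k + 1) (3 * k + 1 + min i (2 * k + 1)) := by
      ext l
      simp only [mem_filter, mem_range, mem_Ioc]
      omega
    rw [this, Nat.card_Ioc]
    omega
  have hrow : ∀ u w : Fin (8 * k + 4),
      #{v | InducedP3 (circPower (8 * k + 4) (3 * k + 1)) u w v} =
        if 1 ≤ cdist _ u w ∧ cdist _ u w ≤ 3 * k + 1 then min (cdist _ u w) (2 * k + 1)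
        else 0 := by
    intro u w
    simp only [inducedP3_circPower_iff (show 2 * (3 * k + 1) < 8 * k + 4 by omega)]
    split_ifs with h
    · simp only [h, true_and, and_true]
      rw [card_filter_cdist u fun l => 3 * k + 1 < l ∧ l ≤ cdist _ u w + (3 * k + 1) ∧
        l + (3 * k + 1) < 8 * k + 4]
      exact hcount _ h
    · simp [h]
  have hIcc : {i ∈ range (8 * k + 4) | 1 ≤ i ∧ i ≤ 3 * k + 1} = Icc 1 (2 * k + 1 + k) := by
    ext i
    simp only [mem_filter, mem_range, mem_Icc]
    omega
  have hgauss : ∀ m : ℕ, 2 * ∑ i ∈ Icc 1 m, i = m * (m + 1) := by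
    intro m
    induction m with
    | zero => simp
    | succ m ih => rw [sum_Icc_succ_top (by omega), mul_add, ih]; ring
  have hsum : ∀ u : Fin (8 * k + 4),
      ∑ w, #{v | InducedP3 (circPower (8 * k + 4) (3 * k + 1)) u w v} = (2 * k + 1) ^ 2 := by
    intro u
    rw [sum_congr rfl fun w _ => hrow u w,
      sum_cdist u fun i => if 1 ≤ i ∧ i ≤ 3 * k + 1 then min i (2 * k + 1) else 0,
      ← sum_filter, hIcc, sum_Icc_min]
    have := hgauss (2 * k + 1)
    nlinarith
  rw [p3Count_eq_sum, sum_congr rfl fun u _ => hsum u, sum_const, card_univ, Fintype.card_fin, smul_eq_mul]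
  ring

theorem cig_p3_bound :
    (∀ (n : ℕ) (E : Fin n → Fin n → Prop) (instE : DecidableRel E), TwoFree E →
      (∃ σ : Equiv.Perm (Fin n), CircInterval n (fun i j => E (σ i) (σ j))) →
      (@p3Count n E instE : ℚ) ≤ (n : ℚ) ^ 3 / 16) ∧
    {n : ℕ | ∃ (E : Fin n → Fin n → Prop) (instE : DecidableRel E),
      TwoFree E ∧ CircInterval n E ∧
        (@p3Count n E instE : ℚ) = (n : ℚ) ^ 3 / 16}.Infinite := by
  refine ⟨fun n E instE hE ⟨σ, hσ⟩ => ?_, ?_⟩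
  · have hE' : TwoFree fun i j => E (σ i) (σ j) :=
      ⟨fun v => hE.1 (σ v), fun u v => hE.2 (σ u) (σ v)⟩
    have h := sixteen_mul_p3Count_le hE' hσ
    rw [p3Count_comp_perm E σ] at h
    have h' : 16 * (p3Count n E : ℚ) ≤ (n : ℚ) ^ 3 := by exact_mod_cast h
    linarith
  · refine Set.infinite_of_injective_forall_mem (f := fun k : ℕ => 8 * k + 4)
      (fun k l h => by dsimp only at h; omega) fun k => ?_
    refine ⟨circPower _ (3 * k + 1), inferInstance, twoFree_circPower (by omega),
      circInterval_circPower _ _, ?_⟩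
    rw [p3Count_circPower]
    push_cast
    ring
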